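/- Let {j_1,…,j_t} ⊆ {1,…,n}, (a_1,…,a_t) ∈ ℕ^t, and let I ⊆ K{y_1,…,y_n} be a pure binomial σ-ideal. Assume there exists a pure binomial Y^f − Y^g ∈ I with Y^f ∈ [y_{j_1}^{x^{a_1}},…,y_{j_t}^{x^{a_t}}] and Y^g ∉ [y_{j_1}^{x^{a_1}},…,y_{j_t}^{x^{a_t}}]. Then there exist l ∈ ℕ and pairs (p_k, b_k) for 1 ≤ k ≤ l, with either p_k ∉ {j_1,…,j_t}, or p_k = j_m and b_k < a_m for some m, such that ⟨I ∪ {y_{j_1}^{x^{a_1}},…,y_{j_t}^{x^{a_t}}}⟩_r = ⋂_{1≤k≤l} ⟨I ∪ {y_{j_1}^{x^{a_1}},…,y_{j_t}^{x^{a_t}}, y_{p_k}^{x^{b_k}}}⟩_r. -/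

import Mathlib

open Polynomial

section SigmaRing

variable {R : Type*} [CommRing R]

/-- A σ-ideal: an ideal closed under the difference operator σ. -/
def IsSigmaIdeal (σ : R →+* R) (I : Ideal R) : Prop := ∀ a ∈ I, σ a ∈ I

/-- A σ-ideal is well-mixed if `a * b ∈ I` implies `a * σ b ∈ I`. -/
def IsWellMixed (σ : R →+* R) (I : Ideal R) : Prop := ∀ a b : R, a * b ∈ I → a * σ b ∈ I

/-- `[F]`, the smallest σ-ideal containing `F`. -/
def sigmaIdealGen (σ : R →+* R) (F : Set R) : Ideal R :=
  sInf {I : Ideal R | F ⊆ I ∧ IsSigmaIdeal σ I}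

/-- `⟨F⟩`, the smallest well-mixed σ-ideal containing `F` (well-mixed closure). -/
def wmClosure (σ : R →+* R) (F : Set R) : Ideal R :=
  sInf {I : Ideal R | F ⊆ I ∧ IsSigmaIdeal σ I ∧ IsWellMixed σ I}

/-- `⟨F⟩_r`, the smallest radical well-mixed σ-ideal containing `F`. -/
def rwmClosure (σ : R →+* R) (F : Set R) : Ideal R :=
  sInf {I : Ideal R | F ⊆ I ∧ IsSigmaIdeal σ I ∧ IsWellMixed σ I ∧ I.IsRadical}

/-- Symbolic exponent: for `p = Σ c_i x^i ∈ ℕ[x]`, `a^p = Π (σ^i a)^(c_i)`. -/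
noncomputable def sexp (σ : R →+* R) (a : R) (p : Polynomial ℕ) : R :=
  ∏ i ∈ Finset.range (p.natDegree + 1), ((⇑σ)^[i] a) ^ (p.coeff i)

/-- `I` is finitely generated as a radical well-mixed σ-ideal. -/
def FinGenAsRWM (σ : R →+* R) (I : Ideal R) : Prop :=
  ∃ G : Set R, G.Finite ∧ G ⊆ (I : Set R) ∧ I = rwmClosure σ G

/-- σ-prime: a reflexive σ-ideal which is prime. -/
def IsSigmaPrime (σ : R →+* R) (I : Ideal R) : Prop :=
  IsSigmaIdeal σ I ∧ (∀ a : R, σ a ∈ I → a ∈ I) ∧ I.IsPrime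

end SigmaRing

/-- The σ-polynomial ring `K{y_1,…,y_n}`: polynomials in variables `y_i^{x^j}`,
indexed by pairs `(i, j) ∈ Fin n × ℕ`. -/
abbrev DPoly (K : Type*) [Field K] (n : ℕ) := MvPolynomial (Fin n × ℕ) K

section DPoly

variable {K : Type*} [Field K] {n : ℕ} (σK : K →+* K)

/-- The difference operator on `K{y_1,…,y_n}` extending `σK`, with `σ(y_i^{x^j}) = y_i^{x^{j+1}}`. -/
noncomputable def shift : DPoly K n →+* DPoly K n :=
  MvPolynomial.eval₂Hom ((MvPolynomial.C : K →+* DPoly K n).comp σK)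
    (fun v => MvPolynomial.X (v.1, v.2 + 1))

/-- `y_i^p` for `p ∈ ℕ[x]`. -/
noncomputable def ypow (i : Fin n) (p : Polynomial ℕ) : DPoly K n :=
  sexp (shift σK) (MvPolynomial.X (i, 0)) p

/-- `y_i^{x^a}`. -/
noncomputable def varPow (i : Fin n) (a : ℕ) : DPoly K n :=
  ypow σK i (Polynomial.X ^ a)

/-- The monomial `Y^f = Π y_i^{f_i}` for `f ∈ ℕ[x]^n`. -/
noncomputable def monom (f : Fin n → Polynomial ℕ) : DPoly K n :=
  ∏ i, ypow σK i (f i)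

/-- A pure binomial `Y^f − Y^g`. -/
def IsPureBinomial (p : DPoly K n) : Prop :=
  ∃ f g : Fin n → Polynomial ℕ, p = monom σK f - monom σK g

/-- A binomial `a·Y^f + b·Y^g` with `a, b ∈ K^×`. -/
def IsBinomial (p : DPoly K n) : Prop :=
  ∃ (a b : K) (f g : Fin n → Polynomial ℕ), a ≠ 0 ∧ b ≠ 0 ∧
    p = MvPolynomial.C a * monom σK f + MvPolynomial.C b * monom σK g

/-- A pure binomial σ-ideal: a σ-ideal generated by pure binomials. -/
def IsPureBinomialSigmaIdeal (I : Ideal (DPoly K n)) : Prop :=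
  ∃ S : Set (DPoly K n), (∀ p ∈ S, IsPureBinomial σK p) ∧ I = sigmaIdealGen (shift σK) S

/-- Positive part of `f ∈ ℤ[x]`. -/
noncomputable def posPart (f : Polynomial ℤ) : Polynomial ℕ :=
  f.sum fun i c => Polynomial.monomial i c.toNat

/-- Negative part of `f ∈ ℤ[x]`. -/
noncomputable def negPart (f : Polynomial ℤ) : Polynomial ℕ :=
  f.sum fun i c => Polynomial.monomial i (-c).toNat

/-- The lattice σ-ideal `I_L = [Y^{f_+} − Y^{f_−} : f ∈ L]` of a ℤ[x]-lattice `L ⊆ ℤ[x]^n`. -/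
noncomputable def latticeIdeal (L : Submodule (Polynomial ℤ) (Fin n → Polynomial ℤ)) :
    Ideal (DPoly K n) :=
  sigmaIdealGen (shift σK)
    {p | ∃ f ∈ L, p = monom σK (fun i => posPart (f i)) - monom σK (fun i => negPart (f i))}

end DPoly

/-- `𝔪`: the multiplicatively closed set generated by the variables `y_i^{x^j}`. -/
def mSet (K : Type*) [Field K] (n : ℕ) : Set (DPoly K n) :=
  (Submonoid.closure (Set.range fun v : Fin n × ℕ => (MvPolynomial.X v : DPoly K n)) : Set _)

/-- `I : 𝔪 = {p : M p ∈ I for some M ∈ 𝔪}`. -/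
def colonM {K : Type*} [Field K] {n : ℕ} (I : Ideal (DPoly K n)) : Set (DPoly K n) :=
  {p | ∃ M ∈ mSet K n, M * p ∈ I}

section Tsec

variable {K : Type*} [Field K] {n t : ℕ} (σK : K →+* K)

/-- The set `T^{a_1…a_t}_{j_1…j_t}` of monomials `Y^f` with `deg f_{j_i} < a_i`. -/
def Tset (j : Fin t → Fin n) (a : Fin t → ℕ) : Set (DPoly K n) :=
  {p | ∃ f : Fin n → Polynomial ℕ,
    (∀ i : Fin t, (f (j i)).degree < (a i : WithBot ℕ)) ∧ p = monom σK f}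

/-- `I` is saturated with respect to `{y_{j_1}^{x^{a_1}},…,y_{j_t}^{x^{a_t}}}`. -/
def SaturatedWrt (j : Fin t → Fin n) (a : Fin t → ℕ) (I : Ideal (DPoly K n)) : Prop :=
  ∀ g M : DPoly K n, M ∈ Tset σK j a → M * g ∈ I → g ∈ I

/-- `J : T = {g : M g ∈ J for some M ∈ T}`. -/
def colonT (j : Fin t → Fin n) (a : Fin t → ℕ) (J : Ideal (DPoly K n)) : Set (DPoly K n) :=
  {g | ∃ M ∈ Tset σK j a, M * g ∈ J}

/-- The `T`-saturated closure `N^{a_1…a_t}_{j_1…j_t}(I)`: the smallest saturated σ-ideal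
containing `I`. -/
noncomputable def Nclosure (j : Fin t → Fin n) (a : Fin t → ℕ) (I : Ideal (DPoly K n)) :
    Ideal (DPoly K n) :=
  sInf {J : Ideal (DPoly K n) | I ≤ J ∧ IsSigmaIdeal (shift σK) J ∧ SaturatedWrt σK j a J}

/-- The set of variables `{y_{j_1}^{x^{a_1}},…,y_{j_t}^{x^{a_t}}}`. -/
noncomputable def varSet (j : Fin t → Fin n) (a : Fin t → ℕ) : Set (DPoly K n) :=
  Set.range fun i => varPow σK (j i) (a i)

/-- `⟨I₀ ∪ {y_{j_1}^{x^{a_1}},…,y_{j_t}^{x^{a_t}}}⟩_r` is quasi-normal. -/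
def QuasiNormal (j : Fin t → Fin n) (a : Fin t → ℕ) (I0 : Ideal (DPoly K n)) : Prop :=
  SaturatedWrt σK j a I0 ∧
  ∀ f g : Fin n → Polynomial ℕ, monom σK f - monom σK g ∈ I0 →
    monom σK f ∈ sigmaIdealGen (shift σK) (varSet σK j a) →
    monom σK g ∈ sigmaIdealGen (shift σK) (varSet σK j a)

end Tsec

section RadicalWellMixed

variable {R : Type*} [CommRing R] {σ : R →+* R}

theorem subset_sigmaIdealGen (F : Set R) : F ⊆ sigmaIdealGen σ F :=
  fun _ hx => Submodule.mem_sInf.2 fun _ hI => hI.1 hx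

theorem isSigmaIdeal_sigmaIdealGen (F : Set R) : IsSigmaIdeal σ (sigmaIdealGen σ F) :=
  fun x hx => Submodule.mem_sInf.2 fun I hI => hI.2 x (Submodule.mem_sInf.1 hx I hI)

theorem sigmaIdealGen_le {F : Set R} {J : Ideal R} (hF : F ⊆ J) (hJ : IsSigmaIdeal σ J) :
    sigmaIdealGen σ F ≤ J :=
  sInf_le ⟨hF, hJ⟩

theorem subset_rwmClosure (F : Set R) : F ⊆ rwmClosure σ F :=
  fun _ hx => Submodule.mem_sInf.2 fun _ hI => hI.1 hx

theorem isSigmaIdeal_rwmClosure (F : Set R) : IsSigmaIdeal σ (rwmClosure σ F) :=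
  fun x hx => Submodule.mem_sInf.2 fun I hI => hI.2.1 x (Submodule.mem_sInf.1 hx I hI)

theorem isWellMixed_rwmClosure (F : Set R) : IsWellMixed σ (rwmClosure σ F) :=
  fun x y hxy => Submodule.mem_sInf.2 fun I hI =>
    hI.2.2.1 x y (Submodule.mem_sInf.1 hxy I hI)

theorem isRadical_rwmClosure (F : Set R) : (rwmClosure σ F).IsRadical := by
  rintro x ⟨m, hm⟩
  exact Submodule.mem_sInf.2 fun I hI => hI.2.2.2 ⟨m, Submodule.mem_sInf.1 hm I hI⟩

theorem rwmClosure_le {F : Set R} {J : Ideal R} (hF : F ⊆ J) (hJ : IsSigmaIdeal σ J)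
    (hwm : IsWellMixed σ J) (hrad : J.IsRadical) : rwmClosure σ F ≤ J :=
  sInf_le ⟨hF, hJ, hwm, hrad⟩

theorem rwmClosure_mono {F G : Set R} (h : F ⊆ G) : rwmClosure σ F ≤ rwmClosure σ G :=
  rwmClosure_le (h.trans (subset_rwmClosure G)) (isSigmaIdeal_rwmClosure G)
    (isWellMixed_rwmClosure G) (isRadical_rwmClosure G)

theorem IsSigmaIdeal.iterate_mem {J : Ideal R} (hJ : IsSigmaIdeal σ J) {x : R} (hx : x ∈ J)
    (k : ℕ) : (⇑σ)^[k] x ∈ J := by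
  induction k with
  | zero => exact hx
  | succ k ih => rw [Function.iterate_succ_apply']; exact hJ _ ih

theorem Ideal.IsRadical.mul_mem_of_mul_mul_mem {J : Ideal R} (hJ : J.IsRadical) {c u : R}
    (h : c * u * u ∈ J) : c * u ∈ J :=
  hJ ⟨2, by simpa [pow_two, mul_comm, mul_left_comm, mul_assoc] using J.mul_mem_left c h⟩

/-- If `d * x ∈ J` with `J` the radical well-mixed closure of `F`, then `d` multiplies the
radical well-mixed closure of `F ∪ {x}` into `J`. -/
theorem mul_mem_rwmClosure {F : Set R} {d x u : R} (hdx : d * x ∈ rwmClosure σ F)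
    (hu : u ∈ rwmClosure σ (F ∪ {x})) : d * u ∈ rwmClosure σ F := by
  set J := rwmClosure σ F with hJ
  have hwm : IsWellMixed σ J := isWellMixed_rwmClosure F
  let Q : Ideal R := Submodule.comap (LinearMap.mulLeft R d) J
  have mem_Q (y : R) : y ∈ Q ↔ d * y ∈ J := Iff.rfl
  refine (mem_Q u).1 (rwmClosure_le (σ := σ) ?_ ?_ ?_ ?_ hu)
  · rintro y (hy | rfl)
    · exact J.mul_mem_left d (subset_rwmClosure F hy)
    · exact hdx
  · exact fun y hy => hwm d y hy
  · intro y z hyz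
    rw [mem_Q, ← mul_assoc] at hyz ⊢
    exact hwm _ _ hyz
  · rintro y ⟨m, hm⟩
    refine (mem_Q y).2 (isRadical_rwmClosure F ⟨m + 1, ?_⟩)
    have : (d * y) ^ (m + 1) = d ^ m * y * (d * y ^ m) := by ring
    rw [this]
    exact J.mul_mem_left _ hm

/-- The elements `P` through which membership in the radical ideal `J` passes to `u`:
`c * P ∈ J` implies `c * u ∈ J`. -/
def passingSubmonoid (J : Ideal R) (hJ : J.IsRadical) (u : R) : Submonoid R where
  carrier := {P | ∀ c, c * P ∈ J → c * u ∈ J}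
  one_mem' c hc := J.mul_mem_right u (by simpa using hc)
  mul_mem' {P Q} hP hQ c hc := by
    refine hJ.mul_mem_of_mul_mul_mem (hP (c * u) ?_)
    rw [mul_right_comm]
    exact hQ (c * P) (by rwa [mul_assoc])

theorem mem_passingSubmonoid_of_mem_rwmClosure {F : Set R} {x u : R}
    (hu : u ∈ rwmClosure σ (F ∪ {x})) :
    x ∈ passingSubmonoid (rwmClosure σ F) (isRadical_rwmClosure F) u :=
  fun _ hc => mul_mem_rwmClosure hc hu

theorem sexp_X_pow (x : R) (b : ℕ) : sexp σ x (X ^ b) = (⇑σ)^[b] x := by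
  rw [sexp, Finset.prod_eq_single b]
  · simp
  · intro i _ hi
    simp [coeff_X_pow, hi]
  · simp

theorem iterate_dvd_sexp (x : R) {p : Polynomial ℕ} {b : ℕ} (hb : b ∈ p.support) :
    (⇑σ)^[b] x ∣ sexp σ x p :=
  (dvd_pow_self _ (mem_support_iff.1 hb)).trans
    (Finset.dvd_prod_of_mem _ (Finset.mem_range_succ_iff.2 (le_natDegree_of_mem_supp b hb)))

theorem sexp_mem {M : Submonoid R} {x : R} {p : Polynomial ℕ}
    (h : ∀ b ∈ p.support, (⇑σ)^[b] x ∈ M) : sexp σ x p ∈ M := by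
  refine M.prod_mem fun b _ => ?_
  by_cases hb : b ∈ p.support
  · exact M.pow_mem (h b hb) _
  · rw [notMem_support_iff.1 hb, pow_zero]
    exact M.one_mem

end RadicalWellMixed

section Monomials

variable {K : Type*} [Field K] {n : ℕ} (σK : K →+* K)

theorem varPow_eq_iterate (i : Fin n) (b : ℕ) :
    varPow σK i b = (⇑(shift σK))^[b] (MvPolynomial.X (i, 0)) :=
  sexp_X_pow _ _

theorem varPow_dvd_monom {g : Fin n → Polynomial ℕ} {i : Fin n} {b : ℕ}
    (hb : b ∈ (g i).support) : varPow σK i b ∣ monom σK g := by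
  rw [varPow_eq_iterate]
  exact (iterate_dvd_sexp _ hb).trans (Finset.dvd_prod_of_mem _ (Finset.mem_univ i))

theorem monom_mem {M : Submonoid (DPoly K n)} {g : Fin n → Polynomial ℕ}
    (h : ∀ i, ∀ b ∈ (g i).support, varPow σK i b ∈ M) : monom σK g ∈ M :=
  M.prod_mem fun i _ => sexp_mem fun b hb => varPow_eq_iterate σK i b ▸ h i b hb

theorem varPow_mem_of_le {J : Ideal (DPoly K n)} (hJ : IsSigmaIdeal (shift σK) J)
    {i : Fin n} {a b : ℕ} (hab : a ≤ b) (ha : varPow σK i a ∈ J) : varPow σK i b ∈ J := by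
  obtain ⟨c, rfl⟩ := Nat.exists_eq_add_of_le' hab
  rw [varPow_eq_iterate] at ha ⊢
  rw [Function.iterate_add_apply]
  exact hJ.iterate_mem ha c

end Monomials

/-- If `I` contains a pure binomial `Y^f − Y^g` with `Y^f ∈ [vars]` and
`Y^g ∉ [vars]`, then `⟨I ∪ {vars}⟩_r = ⋂_k ⟨I ∪ {vars} ∪ {y_{p_k}^{x^{b_k}}}⟩_r`. -/
theorem stmt9 {K : Type*} [Field K] [CharZero K] {n t : ℕ} (σK : K →+* K)
    (j : Fin t → Fin n) (hj : Function.Injective j) (a : Fin t → ℕ)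
    (I : Ideal (DPoly K n)) (hI : IsPureBinomialSigmaIdeal σK I)
    (f g : Fin n → Polynomial ℕ)
    (hfg : monom σK f - monom σK g ∈ I)
    (hf : monom σK f ∈ sigmaIdealGen (shift σK) (varSet σK j a))
    (hg : monom σK g ∉ sigmaIdealGen (shift σK) (varSet σK j a)) :
    ∃ (l : ℕ) (p : Fin l → Fin n) (b : Fin l → ℕ),
      (∀ k : Fin l, (∀ m : Fin t, p k ≠ j m) ∨ ∃ m : Fin t, p k = j m ∧ b k < a m) ∧
      rwmClosure (shift σK) ((I : Set (DPoly K n)) ∪ varSet σK j a) =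
        ⨅ k : Fin l, rwmClosure (shift σK)
          ((I : Set (DPoly K n)) ∪ varSet σK j a ∪ {varPow σK (p k) (b k)}) := by
  set F : Set (DPoly K n) := (I : Set (DPoly K n)) ∪ varSet σK j a with hF
  have hgJ : monom σK g ∈ rwmClosure (shift σK) F := by
    have hfJ : monom σK f ∈ rwmClosure (shift σK) F :=
      sigmaIdealGen_le (Set.subset_union_right.trans (subset_rwmClosure F))
        (isSigmaIdeal_rwmClosure F) hf
    simpa using sub_mem hfJ (subset_rwmClosure F (Or.inl hfg))
  let s : Finset (Σ _ : Fin n, ℕ) := Finset.univ.sigma fun i => (g i).support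
  let e := s.equivFin
  have mem_support (k : Fin s.card) : (e.symm k).1.2 ∈ (g (e.symm k).1.1).support :=
    (Finset.mem_sigma.1 (e.symm k).2).2
  refine ⟨s.card, fun k => (e.symm k).1.1, fun k => (e.symm k).1.2, fun k => ?_, ?_⟩
  · rw [or_iff_not_imp_left]
    intro h
    push Not at h
    obtain ⟨m, hm⟩ := h
    refine ⟨m, hm, lt_of_not_ge fun hle => hg ?_⟩
    refine Ideal.mem_of_dvd _ (varPow_dvd_monom σK (mem_support k)) ?_
    refine varPow_mem_of_le σK (isSigmaIdeal_sigmaIdealGen _) hle ?_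
    rw [hm]
    exact subset_sigmaIdealGen _ ⟨m, rfl⟩
  · refine le_antisymm (le_iInf fun k => rwmClosure_mono Set.subset_union_left) fun u hu => ?_
    rw [Submodule.mem_iInf] at hu
    have hmem : monom σK g ∈ passingSubmonoid _ (isRadical_rwmClosure (σ := shift σK) F) u := by
      refine monom_mem σK fun i b hb => mem_passingSubmonoid_of_mem_rwmClosure ?_
      have hib : (⟨i, b⟩ : Σ _ : Fin n, ℕ) ∈ s := Finset.mem_sigma.2 ⟨Finset.mem_univ i, hb⟩
      simpa using hu (e ⟨⟨i, b⟩, hib⟩)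
    simpa using hmem 1 (by simpa using hgJ)
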